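/- arXiv:2601.17933 — 2 statements merged into one kernel-verified Lean document; each statement's English description precedes it below -/
import Mathlib

section
/- Let τ > 0 and μ ∈ ℝ. In the precision parametrization of the Gaussian family, where the variance is 1/t, the score with respect to the precision is 1/(2τ) − (x − μ)²/2, i.e. the derivative at t = τ of t ↦ log(gaussianPDFReal μ (1/t) x) equals 1/(2τ) − (x − μ)²/2, and the Fisher information in the precision parameter equals ∫ (1/(2τ) − (x − μ)²/2)² d(gaussianReal μ (1/τ))(x) = 1/(2τ²). This is the coefficient g_ττ = 1/(2τ²) of the Fisher–Rao metric ds² = τ dμ² + dτ²/(2τ²) on Gaussian belief states. -/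
open MeasureTheory ProbabilityTheory Real
open scoped NNReal

lemma aux_deriv (v : ℝ) (a b c a' : ℝ → ℝ) (ha : ∀ t, HasDerivAt a (a' t) t)
    (hb : b = fun t => a' t + a t * (v * t)) :
    deriv (fun t => a t * rexp (v * t ^ 2 / 2)) = fun t => b t * rexp (v * t ^ 2 / 2) := by
  funext t
  have h1 : HasDerivAt (fun t : ℝ => v * t ^ 2 / 2) (v * t) t := by
    have := (((hasDerivAt_id t).pow 2).const_mul v).div_const 2
    refine this.congr_deriv ?_
    simp; ring
  have := (ha t).mul h1.exp
  rw [show (fun t => a t * rexp (v * t ^ 2 / 2)) = a * fun t => rexp (v * t ^ 2 / 2) from rfl,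
    this.deriv, hb]
  ring

lemma aux_moments (v : ℝ≥0) :
    (∫ x, x ^ 2 ∂(gaussianReal 0 v)) = v ∧ (∫ x, x ^ 4 ∂(gaussianReal 0 v)) = 3 * (v : ℝ) ^ 2 := by
  have h0 : mgf id (gaussianReal 0 v) = fun t => (fun _ => (1 : ℝ)) t * rexp (v * t ^ 2 / 2) := by
    rw [mgf_id_gaussianReal]; simp
  have key : ∀ n, ∫ x, x ^ n ∂(gaussianReal 0 v) = iteratedDeriv n (mgf id (gaussianReal 0 v)) 0 := by
    intro n
    rw [iteratedDeriv_mgf_zero (by simp [integrableExpSet_id_gaussianReal])]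
    simp
  have d1 := aux_deriv v (fun _ => 1) (fun t => v * t) (fun _ => 0) (fun _ => 0)
    (fun t => hasDerivAt_const t 1) (by funext t; ring)
  have d2 := aux_deriv v (fun t => v * t) (fun t => v + v ^ 2 * t ^ 2) (fun _ => 0) (fun _ => v)
    (fun t => by simpa using (hasDerivAt_id t).const_mul (v : ℝ)) (by funext t; ring)
  have d3 := aux_deriv v (fun t => v + v ^ 2 * t ^ 2) (fun t => 3 * v ^ 2 * t + v ^ 3 * t ^ 3)
    (fun _ => 0) (fun t => 2 * v ^ 2 * t)
    (fun t => by
      refine (((hasDerivAt_pow 2 t).const_mul ((v : ℝ) ^ 2)).const_add (v : ℝ)).congr_deriv ?_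
      norm_num; ring) (by funext t; ring)
  have d4 := aux_deriv v (fun t => 3 * v ^ 2 * t + v ^ 3 * t ^ 3)
    (fun t => 3 * v ^ 2 + 6 * v ^ 3 * t ^ 2 + v ^ 4 * t ^ 4)
    (fun _ => 0) (fun t => 3 * v ^ 2 + 3 * v ^ 3 * t ^ 2)
    (fun t => by
      refine (((hasDerivAt_id t).const_mul (3 * (v : ℝ) ^ 2)).add
        ((hasDerivAt_pow 3 t).const_mul ((v : ℝ) ^ 3))).congr_deriv ?_
      norm_num; ring) (by funext t; ring)
  constructor
  · rw [key, h0]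
    simp only [iteratedDeriv_succ, iteratedDeriv_zero]
    rw [d1, d2]
    simp
  · rw [key, h0]
    simp only [iteratedDeriv_succ, iteratedDeriv_zero]
    rw [d1, d2, d3, d4]
    simp

lemma aux_int (v : ℝ≥0) (n : ℕ) : Integrable (fun x : ℝ => x ^ n) (gaussianReal 0 v) :=
  integrable_pow_of_mem_interior_integrableExpSet (X := id)
    (by simp [integrableExpSet_id_gaussianReal]) n

/-- **Score and Fisher information of the Gaussian family in the precision parameter.**
For `τ > 0` and `μ ∈ ℝ`, in the parametrization where the variance is `1/t`, the
derivative at `t = τ` of `t ↦ log (gaussianPDFReal μ (1/t) x)` equals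
`1/(2τ) − (x − μ)²/2`, and the Fisher information in the precision parameter equals
`∫ (1/(2τ) − (x − μ)²/2)² d(gaussianReal μ (1/τ)) = 1/(2τ²)`, the coefficient
`g_ττ = 1/(2τ²)` of the Fisher–Rao metric `ds² = τ dμ² + dτ²/(2τ²)`. -/
theorem gaussian_precision_score_and_fisher_info
    (μ τ : ℝ) (hτ : 0 < τ) :
    (∀ x : ℝ,
      HasDerivAt (fun t : ℝ => Real.log (gaussianPDFReal μ (Real.toNNReal (1 / t)) x))
        (1 / (2 * τ) - (x - μ) ^ 2 / 2) τ) ∧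
    (∫ x, (1 / (2 * τ) - (x - μ) ^ 2 / 2) ^ 2 ∂(gaussianReal μ (Real.toNNReal (1 / τ))))
      = 1 / (2 * τ ^ 2) := by
  refine ⟨fun x => ?_, ?_⟩
  · have h : HasDerivAt (fun t : ℝ => Real.log t / 2 - Real.log (2 * π) / 2 - t * ((x - μ) ^ 2 / 2))
        (1 / (2 * τ) - (x - μ) ^ 2 / 2) τ := by
      refine ((((Real.hasDerivAt_log hτ.ne').div_const 2).sub_const _).sub
        ((hasDerivAt_id τ).mul_const _)).congr_deriv ?_
      field_simp
    refine h.congr_of_eventuallyEq ?_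
    filter_upwards [lt_mem_nhds hτ] with t ht
    have ht' : (0 : ℝ) ≤ 1 / t := by positivity
    have hs : (√(2 * π * (1 / t))) ≠ 0 := by positivity
    rw [gaussianPDFReal, Real.coe_toNNReal _ ht', Real.log_mul (inv_ne_zero hs) (Real.exp_ne_zero _),
      Real.log_exp, Real.log_inv, Real.log_sqrt (by positivity),
      Real.log_mul (by positivity) (by positivity), one_div, Real.log_inv]
    field_simp
    ring
  · have hv : ((Real.toNNReal (1 / τ) : ℝ≥0) : ℝ) = 1 / τ := Real.coe_toNNReal _ (by positivity)
    set v := Real.toNNReal (1 / τ)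
    obtain ⟨m2, m4⟩ := aux_moments v
    have hmap : gaussianReal μ v = (gaussianReal 0 v).map (· + μ) := by
      rw [gaussianReal_map_add_const, zero_add]
    rw [hmap, integral_map (by fun_prop) (by fun_prop)]
    have he : (fun y : ℝ => (1 / (2 * τ) - (y + μ - μ) ^ 2 / 2) ^ 2)
        = fun y => (1 / (4 * τ ^ 2) - 1 / (2 * τ) * y ^ 2) + 1 / 4 * y ^ 4 := by
      funext y
      field_simp
      ring
    have hi : Integrable (fun y : ℝ => 1 / (4 * τ ^ 2) - 1 / (2 * τ) * y ^ 2) (gaussianReal 0 v) :=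
      (integrable_const _).sub ((aux_int v 2).const_mul _)
    rw [he, integral_add hi
      ((aux_int v 4).const_mul _),
      integral_sub (integrable_const _) ((aux_int v 2).const_mul _), integral_const_mul,
      integral_const_mul, m2, m4, hv]
    simp
    field_simp
    norm_num
end

section
/- Von Mises maximum-entropy principle: let κ > 0 and φ ∈ ℝ, let f(θ) = exp(κ·cos(θ − φ))/Z(κ) with Z(κ) = ∫₀^{2π} exp(κ·cos u) du, and let g : [0, 2π] → ℝ be a nonnegative measurable function with ∫₀^{2π} g(θ) dθ = 1, ∫₀^{2π} cos(θ − φ)·g(θ) dθ = ∫₀^{2π} cos(θ − φ)·f(θ) dθ, and θ ↦ g(θ)·log g(θ) integrable on [0, 2π]. Then ∫₀^{2π} −g(θ)·log g(θ) dθ ≤ ∫₀^{2π} −f(θ)·log f(θ) dθ; i.e., among circular densities with the same first cosine moment about φ, the von Mises density has maximal entropy. -/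
open Real MeasureTheory

/-- **Von Mises maximum-entropy principle.**  Let `κ > 0`, `φ ∈ ℝ`,
`f(θ) = exp(κ cos(θ − φ))/Z(κ)` with `Z(κ) = ∫₀^{2π} exp(κ cos u) du`.  If
`g : ℝ → ℝ` is a nonnegative measurable circular density on `[0, 2π]` with the same
first cosine moment about `φ` as `f`, and `g·log g` is integrable on `[0, 2π]`, then
the entropy of `g` is at most that of `f`: among circular densities with the same
first cosine moment, the von Mises density has maximal entropy. -/
theorem vonMises_maximum_entropy
    (κ φ : ℝ) (hκ : 0 < κ)
    (Z : ℝ) (hZ : Z = ∫ u in (0:ℝ)..(2 * π), Real.exp (κ * Real.cos u))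
    (f : ℝ → ℝ) (hf : ∀ θ : ℝ, f θ = Real.exp (κ * Real.cos (θ - φ)) / Z)
    (g : ℝ → ℝ) (hg_nonneg : ∀ θ : ℝ, 0 ≤ g θ) (hg_meas : Measurable g)
    (hg_int : (∫ θ in (0:ℝ)..(2 * π), g θ) = 1)
    (hg_moment : (∫ θ in (0:ℝ)..(2 * π), Real.cos (θ - φ) * g θ)
      = ∫ θ in (0:ℝ)..(2 * π), Real.cos (θ - φ) * f θ)
    (hg_ent : IntervalIntegrable (fun θ : ℝ => g θ * Real.log (g θ)) volume 0 (2 * π)) :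
    (∫ θ in (0:ℝ)..(2 * π), -(g θ * Real.log (g θ)))
      ≤ ∫ θ in (0:ℝ)..(2 * π), -(f θ * Real.log (f θ)) := by
  have hpi : (0:ℝ) < 2 * π := by positivity
  have hZpos : 0 < Z := by
    rw [hZ]
    apply intervalIntegral.intervalIntegral_pos_of_pos
    · exact Continuous.intervalIntegrable (by fun_prop) _ _
    · intro x; exact Real.exp_pos _
    · exact hpi
  have hfc : Continuous f := by
    have : f = fun θ => Real.exp (κ * Real.cos (θ - φ)) / Z := funext hf
    rw [this]; fun_prop
  have hfpos : ∀ θ, 0 < f θ := fun θ => by rw [hf]; positivity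
  have hlogf : ∀ θ, Real.log (f θ) = κ * Real.cos (θ - φ) - Real.log Z := fun θ => by
    rw [hf, Real.log_div (Real.exp_pos _).ne' hZpos.ne', Real.log_exp]
  have hfint : (∫ θ in (0:ℝ)..(2 * π), f θ) = 1 := by
    have hper : Function.Periodic (fun u : ℝ => Real.exp (κ * Real.cos u)) (2 * π) := by
      intro u; simp only [Real.cos_add_two_pi]
    have h1 : (∫ θ in (0:ℝ)..(2 * π), Real.exp (κ * Real.cos (θ - φ))) = Z := by
      rw [intervalIntegral.integral_comp_sub_right
        (fun u : ℝ => Real.exp (κ * Real.cos u)) φ, hZ]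
      have h2 := hper.intervalIntegral_add_eq (0 - φ) 0
      rw [zero_add] at h2
      rw [← h2]
      congr 1
      ring
    simp only [hf]
    rw [intervalIntegral.integral_div, h1, div_self hZpos.ne']
  have hgI : IntervalIntegrable g volume 0 (2 * π) := by
    by_contra h
    rw [intervalIntegral.integral_undef h] at hg_int
    exact zero_ne_one hg_int
  have hfI : IntervalIntegrable f volume 0 (2 * π) := hfc.intervalIntegrable _ _
  have hcg : IntervalIntegrable (fun θ => Real.cos (θ - φ) * g θ) volume 0 (2 * π) :=
    hgI.continuousOn_mul (by fun_prop)
  have hcf : IntervalIntegrable (fun θ => Real.cos (θ - φ) * f θ) volume 0 (2 * π) :=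
    hfI.continuousOn_mul (by fun_prop)
  have hpt : ∀ θ, -(g θ * Real.log (g θ)) ≤
      (Real.log Z - 1) * g θ - κ * (Real.cos (θ - φ) * g θ) + f θ := by
    intro θ
    have key : -(g θ * Real.log (g θ)) ≤ -(g θ * Real.log (f θ)) + f θ - g θ := by
      rcases (hg_nonneg θ).eq_or_lt with h | h
      · rw [← h]; simpa using (hfpos θ).le
      · have h1 := Real.log_le_sub_one_of_pos (div_pos (hfpos θ) h)
        rw [Real.log_div (hfpos θ).ne' h.ne'] at h1
        have h2 := mul_le_mul_of_nonneg_left h1 h.le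
        have h3 : g θ * (f θ / g θ - 1) = f θ - g θ := by field_simp
        rw [h3] at h2
        linarith
    rw [hlogf] at key
    linarith
  have hI1 := (hgI.const_mul (Real.log Z - 1)).sub (hcg.const_mul κ)
  calc (∫ θ in (0:ℝ)..(2 * π), -(g θ * Real.log (g θ)))
      ≤ ∫ θ in (0:ℝ)..(2 * π),
        ((Real.log Z - 1) * g θ - κ * (Real.cos (θ - φ) * g θ) + f θ) :=
        intervalIntegral.integral_mono_on hpi.le hg_ent.neg (hI1.add hfI) (fun θ _ => hpt θ)
    _ = Real.log Z - κ * ∫ θ in (0:ℝ)..(2 * π), Real.cos (θ - φ) * f θ := by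
        rw [intervalIntegral.integral_add hI1 hfI,
          intervalIntegral.integral_sub (hgI.const_mul _) (hcg.const_mul κ),
          intervalIntegral.integral_const_mul, intervalIntegral.integral_const_mul,
          hg_int, hfint, hg_moment]
        ring
    _ = ∫ θ in (0:ℝ)..(2 * π), (Real.log Z * f θ - κ * (Real.cos (θ - φ) * f θ)) := by
        rw [intervalIntegral.integral_sub (hfI.const_mul _) (hcf.const_mul κ),
          intervalIntegral.integral_const_mul, intervalIntegral.integral_const_mul, hfint]
        ring
    _ = ∫ θ in (0:ℝ)..(2 * π), -(f θ * Real.log (f θ)) := by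
        congr 1
        funext θ
        rw [hlogf]
        ring
end
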